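/- arXiv:2407.15210 — 2 statements merged into one kernel-verified Lean document; each statement's English description precedes it below -/
import Mathlib

section
/- If 0 < a ≤ 1/e, then an element t of the extended real line EReal is representable if and only if t does not belong to X. -/
open Filter Topology

/-- Exponential on the extended real line, with e^{-∞}=0 and e^{+∞}=+∞. -/
noncomputable def eexp (y : EReal) : EReal :=
  if y = ⊥ then (0 : EReal) else if y = ⊤ then ⊤ else ((Real.exp y.toReal : ℝ) : EReal)

/-- `fSgn a s` is `f₊ : x ↦ e^{a·x}` when `s = true` and `f₋ : x ↦ -e^{a·x}` when `s = false`. -/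
noncomputable def fSgn (a : ℝ) (s : Bool) (x : EReal) : EReal :=
  if s then eexp ((a : EReal) * x) else -eexp ((a : EReal) * x)

/-- `uSeq a n ε = f_{ε₁}(f_{ε₂}(⋯ f_{ε_n}(1)⋯))`, where `ε (k-1)` is the k-th sign. -/
noncomputable def uSeq (a : ℝ) : ℕ → (ℕ → Bool) → EReal
  | 0, _ => 1
  | n + 1, ε => fSgn a (ε 0) (uSeq a n (fun k => ε (k + 1)))

/-- `ε` represents `t` if `(u_{n,ε})_n` tends to `t` in `EReal`. -/
def Represents (a : ℝ) (ε : ℕ → Bool) (t : EReal) : Prop :=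
  Filter.Tendsto (fun n => uSeq a n ε) Filter.atTop (nhds t)

/-- `t` is representable if some sign sequence represents it. -/
def Representable (a : ℝ) (t : EReal) : Prop :=
  ∃ ε : ℕ → Bool, Represents a ε t

/-- For a finite word `γ = γ₁⋯γ_k`, `fWord a γ = f_{γ₁} ∘ ⋯ ∘ f_{γ_k}`. -/
noncomputable def fWord (a : ℝ) (γ : List Bool) (x : EReal) : EReal :=
  γ.foldr (fSgn a) x

/-- `I(ε) = ⋂ₙ I(n,ε)` where `I(n,ε)` is the image of `EReal` under `f_{ε₁} ∘ ⋯ ∘ f_{ε_n}`. -/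
noncomputable def Iset (a : ℝ) (ε : ℕ → Bool) : Set EReal :=
  ⋂ n : ℕ, Set.range (fWord a (List.ofFn fun i : Fin n => ε i))

/-- `X` is the union over all finite words `γ` of the images `f_γ(]m,+∞])`. -/
noncomputable def Xset (a m : ℝ) : Set EReal :=
  ⋃ γ : List Bool, fWord a γ '' Set.Ioi (m : EReal)

/-- Real version of `fSgn`. -/
noncomputable def gR (a : ℝ) (s : Bool) (x : ℝ) : ℝ :=
  if s then Real.exp (a * x) else -Real.exp (a * x)

/-- Real version of `uSeq`. -/
noncomputable def vR (a : ℝ) : ℕ → (ℕ → Bool) → ℝ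
  | 0, _ => 1
  | n + 1, ε => gR a (ε 0) (vR a n (fun k => ε (k + 1)))

lemma eexp_coe (x : ℝ) : eexp (x : EReal) = ((Real.exp x : ℝ) : EReal) := by
  simp [eexp]

lemma fSgn_coe (a : ℝ) (s : Bool) (x : ℝ) : fSgn a s (x : EReal) = ((gR a s x : ℝ) : EReal) := by
  unfold fSgn gR
  rw [← EReal.coe_mul, eexp_coe]
  cases s <;> simp

lemma fSgn_top {a : ℝ} (ha : 0 < a) (s : Bool) : fSgn a s ⊤ = if s then ⊤ else ⊥ := by
  unfold fSgn
  rw [EReal.coe_mul_top_of_pos ha]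
  cases s <;> simp [eexp]

lemma fSgn_bot {a : ℝ} (ha : 0 < a) (s : Bool) : fSgn a s ⊥ = 0 := by
  unfold fSgn
  rw [EReal.coe_mul_bot_of_pos ha]
  cases s <;> simp [eexp]

lemma uSeq_coe (a : ℝ) (n : ℕ) : ∀ ε, uSeq a n ε = ((vR a n ε : ℝ) : EReal) := by
  induction n with
  | zero => intro ε; simp [uSeq, vR]
  | succ n ih => intro ε; simp only [uSeq, vR]; rw [ih, fSgn_coe]

lemma abs_gR (a : ℝ) (s : Bool) (x : ℝ) : |gR a s x| = Real.exp (a * x) := by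
  unfold gR; cases s <;> simp

lemma vR_abs_le {a m : ℝ} (ha : 0 < a) (hm : Real.exp (a * m) = m) (h1 : 1 < m) (n : ℕ) :
    ∀ ε, |vR a n ε| ≤ m := by
  induction n with
  | zero => intro ε; simp [vR]; exact h1.le
  | succ n ih =>
    intro ε
    simp only [vR]
    rw [abs_gR]
    have := (abs_le.1 (ih (fun k => ε (k + 1)))).2
    calc _ ≤ Real.exp (a * m) := Real.exp_le_exp.2 (by gcongr)
      _ = m := hm

lemma one_lt_m {a m : ℝ} (ha : 0 < a) (hm : Real.exp (a * m) = m) : 1 < m := by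
  have h0 : 0 < m := hm ▸ Real.exp_pos _
  rw [← hm]
  exact Real.one_lt_exp_iff.2 (by positivity)

lemma am_le_one {a m : ℝ} (ha : 0 < a) (ha' : a ≤ 1 / Real.exp 1)
    (hmin : ∀ m' : ℝ, Real.exp (a * m') = m' → m ≤ m') : a * m ≤ 1 := by
  have hc : ContinuousOn (fun x : ℝ => x - Real.exp (a * x)) (Set.Icc 0 (1 / a)) := by fun_prop
  have hp : (0 : ℝ) ≤ 1 / a := by positivity
  have hmem : (0 : ℝ) ∈ Set.Icc ((fun x : ℝ => x - Real.exp (a * x)) 0)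
      ((fun x : ℝ => x - Real.exp (a * x)) (1 / a)) := by
    constructor
    · simp
    · have : a * (1 / a) = 1 := by field_simp
      simp only [this]
      have h := Real.exp_pos 1
      rw [sub_nonneg, le_div_iff₀ ha]
      rwa [le_div_iff₀ h, mul_comm] at ha'
  obtain ⟨x, hx, hx'⟩ := intermediate_value_Icc hp hc hmem
  have := hmin x (by simp only at hx'; linarith)
  have h2 : m ≤ 1 / a := this.trans hx.2
  rw [le_div_iff₀ ha] at h2
  linarith

/-- The contraction modulus. -/
noncomputable def phi (a m d : ℝ) : ℝ := m * (1 - Real.exp (-(a * d)))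

lemma phi_mono {a m : ℝ} (ha : 0 < a) (h0 : 0 < m) : Monotone (phi a m) := by
  intro x y h
  unfold phi
  gcongr

lemma phi_le {a m : ℝ} (h0 : 0 < m) (ham : a * m ≤ 1) {d : ℝ} (hd : 0 ≤ d) : phi a m d ≤ d := by
  unfold phi
  have := Real.add_one_le_exp (-(a * d))
  calc _ ≤ m * (a * d) := by gcongr; linarith
    _ = (a * m) * d := by ring
    _ ≤ 1 * d := by gcongr
    _ = d := one_mul d

lemma phi_fix {a m : ℝ} (ha : 0 < a) (h0 : 0 < m) (ham : a * m ≤ 1) {d : ℝ} (hd : 0 ≤ d)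
    (h : phi a m d = d) : d = 0 := by
  by_contra hne
  have hpos : 0 < d := lt_of_le_of_ne hd (Ne.symm hne)
  have hlt : phi a m d < d := by
    unfold phi
    have := Real.add_one_lt_exp (x := -(a * d)) (neg_neg_of_pos (mul_pos ha hpos)).ne
    calc _ < m * (a * d) := by gcongr; linarith
      _ = (a * m) * d := by ring
      _ ≤ 1 * d := by gcongr
      _ = d := one_mul d
  linarith

lemma phi_nonneg {a m : ℝ} (ha : 0 < a) (h0 : 0 < m) {d : ℝ} (hd : 0 ≤ d) : 0 ≤ phi a m d := by
  have := phi_mono ha h0 hd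
  simpa [phi] using this

lemma phi_iter_nonneg {a m : ℝ} (ha : 0 < a) (h0 : 0 < m) {d : ℝ} (hd : 0 ≤ d) (n : ℕ) :
    0 ≤ (phi a m)^[n] d := by
  induction n with
  | zero => simpa
  | succ n ih => rw [Function.iterate_succ_apply']; exact phi_nonneg ha h0 ih

lemma phi_iter_tendsto {a m : ℝ} (ha : 0 < a) (h0 : 0 < m) (ham : a * m ≤ 1) {d : ℝ}
    (hd : 0 ≤ d) : Tendsto (fun n => (phi a m)^[n] d) atTop (𝓝 0) := by
  have hanti : Antitone (fun n => (phi a m)^[n] d) := by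
    apply antitone_nat_of_succ_le
    intro n
    rw [Function.iterate_succ_apply']
    exact phi_le h0 ham (phi_iter_nonneg ha h0 hd n)
  have hb : BddBelow (Set.range (fun n => (phi a m)^[n] d)) :=
    ⟨0, by rintro _ ⟨n, rfl⟩; exact phi_iter_nonneg ha h0 hd n⟩
  have ht := tendsto_atTop_ciInf hanti hb
  have hc : Continuous (phi a m) := by unfold phi; fun_prop
  have hfix := isFixedPt_of_tendsto_iterate ht hc.continuousAt
  have hL := ge_of_tendsto' ht (phi_iter_nonneg ha h0 hd)
  rw [phi_fix ha h0 ham hL hfix] at ht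
  exact ht

lemma exp_sub_le {a m : ℝ} (ha : 0 < a) (hm : Real.exp (a * m) = m) {x y : ℝ}
    (hx : x ≤ m) (hy : y ≤ x) :
    |Real.exp (a * x) - Real.exp (a * y)| ≤ phi a m |x - y| := by
  have h1 : Real.exp (a * y) ≤ Real.exp (a * x) := Real.exp_le_exp.2 (by gcongr)
  rw [abs_of_nonneg (by linarith), abs_of_nonneg (by linarith)]
  have h2 : Real.exp (a * y) = Real.exp (a * x) * Real.exp (-(a * (x - y))) := by
    rw [← Real.exp_add]; congr 1; ring
  have h3 : Real.exp (a * x) ≤ m := by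
    rw [← hm]; rw [hm]; exact Real.exp_le_exp.2 (by gcongr) |>.trans hm.le
  have h4 : Real.exp (-(a * (x - y))) ≤ 1 := by
    apply Real.exp_le_one_iff.2
    have := mul_nonneg ha.le (sub_nonneg.2 hy)
    linarith
  unfold phi
  rw [h2]
  calc _ = Real.exp (a * x) * (1 - Real.exp (-(a * (x - y)))) := by ring
    _ ≤ _ := mul_le_mul_of_nonneg_right h3 (by linarith)

lemma gR_sub_le {a m : ℝ} (ha : 0 < a) (hm : Real.exp (a * m) = m) {x y : ℝ} (s : Bool)
    (hx : x ≤ m) (hy : y ≤ m) :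
    |gR a s x - gR a s y| ≤ phi a m |x - y| := by
  have key : |gR a s x - gR a s y| = |Real.exp (a * x) - Real.exp (a * y)| := by
    unfold gR
    cases s
    · simp only [Bool.false_eq_true, if_false]
      rw [abs_sub_comm]; congr 1; ring
    · simp
  rw [key]
  rcases le_total y x with h | h
  · exact exp_sub_le ha hm hx h
  · rw [abs_sub_comm, abs_sub_comm x y]; exact exp_sub_le ha hm hy h

lemma mem_X_of_gt {a m : ℝ} {t : EReal} (h : (m : EReal) < t) : t ∈ Xset a m :=
  Set.mem_iUnion.2 ⟨[], t, h, rfl⟩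

lemma mem_X_fSgn {a m : ℝ} {t : EReal} (s : Bool) (h : t ∈ Xset a m) :
    fSgn a s t ∈ Xset a m := by
  obtain ⟨γ, x, hx, rfl⟩ := Set.mem_iUnion.1 h
  exact Set.mem_iUnion.2 ⟨s :: γ, x, hx, rfl⟩

/-- The inverse branch. -/
noncomputable def tR (a t : ℝ) : ℝ := Real.log t / a

lemma gR_tR {a t : ℝ} (ha : 0 < a) (ht : t ≠ 0) : gR a (decide (0 < t)) (tR a t) = t := by
  have h : a * tR a t = Real.log t := by unfold tR; field_simp
  unfold gR
  rw [h, Real.exp_log_eq_abs ht]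
  rcases lt_or_gt_of_ne ht with h | h
  · simp [not_lt.2 h.le, abs_of_neg h]
  · simp [h, abs_of_pos h]

lemma tR_gR {a y : ℝ} (ha : 0 < a) (s : Bool) : tR a (gR a s y) = y := by
  unfold tR
  rw [← Real.log_abs, abs_gR, Real.log_exp]
  field_simp

/-- Properties of points out of `X`. -/
lemma notX {a m : ℝ} (ha : 0 < a) (hm : Real.exp (a * m) = m) {t : ℝ}
    (ht : (t : EReal) ∉ Xset a m) :
    |t| ≤ m ∧ t ≠ 0 ∧ ((tR a t : ℝ) : EReal) ∉ Xset a m := by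
  have ht0 : t ≠ 0 := by
    rintro rfl
    apply ht
    have h1 : (⊤ : EReal) ∈ Xset a m := mem_X_of_gt (EReal.coe_lt_top m)
    have h2 := mem_X_fSgn false (mem_X_fSgn false h1)
    rw [fSgn_top ha] at h2
    simp only [Bool.false_eq_true, if_false] at h2
    rw [fSgn_bot ha] at h2
    exact_mod_cast h2
  have h3 : ((tR a t : ℝ) : EReal) ∉ Xset a m := by
    intro h
    apply ht
    have := mem_X_fSgn (decide (0 < t)) h
    rwa [fSgn_coe, gR_tR ha ht0] at this
  refine ⟨?_, ht0, h3⟩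
  have h4 : tR a t ≤ m := by
    by_contra hh
    exact h3 (mem_X_of_gt (by exact_mod_cast not_le.1 hh))
  rw [← gR_tR ha ht0, abs_gR, ← hm]
  rw [hm]
  exact (Real.exp_le_exp.2 (by gcongr)).trans hm.le

lemma approx {a m : ℝ} (ha : 0 < a) (hm : Real.exp (a * m) = m) (n : ℕ) :
    ∀ t : ℝ, (t : EReal) ∉ Xset a m →
      |vR a n (fun k => decide (0 < (tR a)^[k] t)) - t| ≤ (phi a m)^[n] (2 * m) := by
  have h1 := one_lt_m ha hm
  induction n with
  | zero =>
    intro t ht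
    have := abs_le.1 (notX ha hm ht).1
    simp only [vR, Function.iterate_zero, id]
    rw [abs_le]; constructor <;> linarith
  | succ n ih =>
    intro t ht
    obtain ⟨-, h0, h3⟩ := notX ha hm ht
    rw [Function.iterate_succ_apply']
    have hg := gR_tR ha h0
    have ih' := ih _ h3
    simp only [vR, Function.iterate_succ_apply, Function.iterate_zero, id]
    conv_lhs => rw [← hg]
    have key := gR_sub_le ha hm (decide (0 < t))
      (abs_le.1 (vR_abs_le ha hm h1 n (fun k => decide (0 < (tR a)^[k] (tR a t))))).2
      (abs_le.1 (notX ha hm h3).1).2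
    have key2 := key.trans (phi_mono ha (by linarith) ih')
    rw [hg] at key2 ⊢
    exact key2

lemma Represents.real {a m : ℝ} (ha : 0 < a) (hm : Real.exp (a * m) = m) {ε : ℕ → Bool}
    {t : EReal} (h : Represents a ε t) :
    ∃ r : ℝ, t = r ∧ Tendsto (fun n => vR a n ε) atTop (𝓝 r) ∧ r ≤ m := by
  have hb := fun n => abs_le.1 (vR_abs_le ha hm (one_lt_m ha hm) n ε)
  unfold Represents at h
  simp only [uSeq_coe] at h
  have hu : t ≤ (m : EReal) := le_of_tendsto' h (fun n => by exact_mod_cast (hb n).2)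
  have hl : ((-m : ℝ) : EReal) ≤ t := ge_of_tendsto' h (fun n => by exact_mod_cast (hb n).1)
  induction t with
  | bot => simp at hl
  | top => simp at hu
  | coe r => exact ⟨r, rfl, EReal.tendsto_coe.1 h, by exact_mod_cast hu⟩

lemma Representable.of_fSgn {a m : ℝ} (ha : 0 < a) (hm : Real.exp (a * m) = m) {s : Bool}
    {y : EReal} (h : Representable a (fSgn a s y)) : Representable a y := by
  obtain ⟨ε, hε⟩ := h
  obtain ⟨r, hr, ht, -⟩ := hε.real ha hm
  have hr0 : r ≠ 0 := by
    have h1 : Real.exp (-(a * m)) ≤ |r| := by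
      apply ge_of_tendsto ht.abs
      filter_upwards [eventually_ge_atTop 1] with n hn
      obtain ⟨k, rfl⟩ := Nat.exists_eq_add_of_le' hn
      simp only [vR, abs_gR]
      have := (abs_le.1 (vR_abs_le ha hm (one_lt_m ha hm) k (fun k => ε (k + 1)))).1
      apply Real.exp_le_exp.2
      rw [← mul_neg]
      gcongr
    exact abs_pos.1 ((Real.exp_pos _).trans_le h1)
  induction y with
  | bot => rw [fSgn_bot ha] at hr; exact absurd (by exact_mod_cast hr.symm) hr0
  | top => rw [fSgn_top ha] at hr; cases s <;> simp at hr
  | coe y =>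
    rw [fSgn_coe] at hr
    have hr' : gR a s y = r := by exact_mod_cast hr
    refine ⟨fun k => ε (k + 1), ?_⟩
    unfold Represents
    simp only [uSeq_coe]
    rw [EReal.tendsto_coe]
    have h2 := ((tendsto_add_atTop_iff_nat 1).2 ht).log hr0
    have h3 := h2.div_const a
    simp only [vR] at h3
    change Tendsto (fun k => tR a (gR a (ε 0) _)) _ (𝓝 (tR a r)) at h3
    rw [← hr'] at h3
    simpa only [tR_gR ha] using h3

lemma not_repr_word {a m : ℝ} (ha : 0 < a) (hm : Real.exp (a * m) = m) {x : EReal}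
    (γ : List Bool) (h : Representable a (fWord a γ x)) : Representable a x := by
  induction γ with
  | nil => exact h
  | cons s γ ih => exact ih (Representable.of_fSgn (s := s) ha hm h)

/-- If `0 < a ≤ 1/e` and `m` is the smallest real fixed point of `x ↦ e^{a·x}`,
then `t` is representable iff `t ∉ X`. -/
theorem representable_iff_not_mem_X (a m : ℝ) (ha : 0 < a) (ha' : a ≤ 1 / Real.exp 1)
    (hm : Real.exp (a * m) = m) (hmin : ∀ m' : ℝ, Real.exp (a * m') = m' → m ≤ m') :
    ∀ t : EReal, Representable a t ↔ t ∉ Xset a m := by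
  intro t
  have h1 := one_lt_m ha hm
  have ham := am_le_one ha ha' hmin
  constructor
  · intro h hX
    obtain ⟨γ, x, hx, rfl⟩ := Set.mem_iUnion.1 hX
    obtain ⟨ε, hε⟩ := not_repr_word ha hm γ h
    obtain ⟨r, rfl, -, hr⟩ := hε.real ha hm
    have : m < r := EReal.coe_lt_coe_iff.1 hx
    linarith
  · intro h
    have htop : (⊤ : EReal) ∈ Xset a m := mem_X_of_gt (EReal.coe_lt_top m)
    induction t with
    | bot =>
      have h2 := mem_X_fSgn false htop
      rw [fSgn_top ha] at h2
      exact absurd h2 h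
    | top => exact absurd htop h
    | coe t =>
      refine ⟨fun k => decide (0 < (tR a)^[k] t), ?_⟩
      unfold Represents
      simp only [uSeq_coe]
      rw [EReal.tendsto_coe, tendsto_iff_dist_tendsto_zero]
      refine squeeze_zero (fun _ => dist_nonneg) (fun n => ?_)
        (phi_iter_tendsto ha (by linarith) ham (d := 2 * m) (by linarith))
      rw [Real.dist_eq]
      exact approx ha hm n t h
end

section
/- Let a > 0. The following are equivalent: (i) every element of EReal is representable; (ii) for every sign sequence ε the set I(ε) is a subsingleton; (iii) every sign sequence represents an element of EReal and every element of EReal is representable (i.e., a is suitable). -/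
open Filter Topology

lemma mulA_strictMono {a : ℝ} (ha : 0 < a) : StrictMono (fun x : EReal => (a : EReal) * x) := by
  have h1 : Monotone (fun x : EReal => (a : EReal) * x) := fun x y h =>
    mul_le_mul_of_nonneg_left h (by exact_mod_cast ha.le)
  refine h1.strictMono_of_injective ?_
  intro x y h
  have key : ∀ z : EReal, (a : EReal) * z / (a : EReal) = z := by
    intro z
    rw [← EReal.mul_div, EReal.mul_div_cancel (EReal.coe_ne_bot a) (EReal.coe_ne_top a)
      (by exact_mod_cast ha.ne')]
  have h' : (a : EReal) * x = (a : EReal) * y := h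
  rw [← key x, h', key y]

lemma mulA_continuous {a : ℝ} (ha : 0 < a) : Continuous (fun x : EReal => (a : EReal) * x) := by
  refine (mulA_strictMono ha).monotone.continuous_of_surjective ?_
  intro y
  exact ⟨y / (a : EReal), EReal.mul_div_cancel (EReal.coe_ne_bot a) (EReal.coe_ne_top a)
      (by exact_mod_cast ha.ne')⟩

lemma eexp_eq (y : EReal) : eexp y = ((EReal.exp y : ENNReal) : EReal) := by
  unfold eexp
  induction y with
  | bot => simp
  | top => simp
  | coe r => simp [EReal.coe_ennreal_ofReal, (Real.exp_pos r).le]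

lemma eexp_nonneg (y : EReal) : 0 ≤ eexp y := by
  rw [eexp_eq]; exact EReal.coe_ennreal_nonneg _

lemma eexp_strictMono : StrictMono eexp := by
  have : eexp = fun y => ((EReal.exp y : ENNReal) : EReal) := funext eexp_eq
  rw [this]
  exact EReal.coe_ennreal_strictMono.comp EReal.exp_strictMono

lemma eexp_continuous : Continuous eexp := by
  have : eexp = fun y => ((EReal.exp y : ENNReal) : EReal) := funext eexp_eq
  rw [this]
  exact continuous_coe_ennreal_ereal.comp ENNReal.continuous_exp

lemma eexp_surj {t : EReal} (ht : 0 ≤ t) : ∃ y, eexp y = t := by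
  refine ⟨ENNReal.log t.toENNReal, ?_⟩
  rw [eexp_eq, ENNReal.exp_log, EReal.coe_toENNReal ht]

lemma fT_strictMono {a : ℝ} (ha : 0 < a) : StrictMono (fSgn a true) := by
  intro x y h
  simpa [fSgn] using eexp_strictMono (mulA_strictMono ha h)

lemma fF_strictAnti {a : ℝ} (ha : 0 < a) : StrictAnti (fSgn a false) := by
  intro x y h
  have := eexp_strictMono (mulA_strictMono ha h)
  simpa [fSgn, EReal.neg_lt_neg_iff] using this

lemma fSgn_injective {a : ℝ} (ha : 0 < a) (s : Bool) : Function.Injective (fSgn a s) := by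
  cases s
  · exact (fF_strictAnti ha).injective
  · exact (fT_strictMono ha).injective

lemma fSgn_continuous {a : ℝ} (ha : 0 < a) (s : Bool) : Continuous (fSgn a s) := by
  have h : Continuous (fun x : EReal => eexp ((a : EReal) * x)) :=
    eexp_continuous.comp (mulA_continuous ha)
  cases s
  · have : fSgn a false = fun x => - eexp ((a : EReal) * x) := by funext x; simp [fSgn]
    rw [this]; exact continuous_neg.comp h
  · have : fSgn a true = fun x => eexp ((a : EReal) * x) := by funext x; simp [fSgn]
    rw [this]; exact h

lemma fT_nonneg (a : ℝ) (x : EReal) : 0 ≤ fSgn a true x := by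
  simpa [fSgn] using eexp_nonneg _

lemma fF_nonpos (a : ℝ) (x : EReal) : fSgn a false x ≤ 0 := by
  have := eexp_nonneg ((a : EReal) * x)
  simp only [fSgn, Bool.false_eq_true, if_false]
  rw [EReal.neg_le, neg_zero]; exact this

lemma fSgn_surj {a : ℝ} (ha : 0 < a) (t : EReal) : ∃ s x, fSgn a s x = t := by
  have key : ∀ r : EReal, 0 ≤ r → ∃ x : EReal, eexp ((a : EReal) * x) = r := by
    intro r hr
    obtain ⟨y, hy⟩ := eexp_surj hr
    refine ⟨y / (a : EReal), ?_⟩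
    rw [EReal.mul_div_cancel (EReal.coe_ne_bot a) (EReal.coe_ne_top a)
      (by exact_mod_cast ha.ne'), hy]
  rcases le_total 0 t with h | h
  · obtain ⟨x, hx⟩ := key t h
    exact ⟨true, x, by simpa [fSgn] using hx⟩
  · obtain ⟨x, hx⟩ := key (-t) (by rw [EReal.le_neg, neg_zero]; exact h)
    exact ⟨false, x, by simp [fSgn, hx]⟩

lemma fWord_continuous {a : ℝ} (ha : 0 < a) (γ : List Bool) : Continuous (fWord a γ) := by
  induction γ with
  | nil => exact continuous_id
  | cons s γ ih => exact (fSgn_continuous ha s).comp ih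

lemma fWord_ofFn_succ (a : ℝ) (n : ℕ) (ε : ℕ → Bool) (x : EReal) :
    fWord a (List.ofFn fun i : Fin (n + 1) => ε i) x =
      fSgn a (ε 0) (fWord a (List.ofFn fun i : Fin n => ε (i + 1)) x) := by
  simp [fWord, List.ofFn_succ]

lemma isClosed_range_fWord {a : ℝ} (ha : 0 < a) (γ : List Bool) :
    IsClosed (Set.range (fWord a γ)) :=
  (isCompact_range (fWord_continuous ha γ)).isClosed

lemma uSeq_mem (a : ℝ) (n k : ℕ) (ε : ℕ → Bool) :
    uSeq a (n + k) ε ∈ Set.range (fWord a (List.ofFn fun i : Fin n => ε i)) := by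
  induction n generalizing ε with
  | zero => exact ⟨uSeq a (0 + k) ε, by simp [fWord]⟩
  | succ n ih =>
    obtain ⟨z, hz⟩ := ih (fun k => ε (k + 1))
    refine ⟨z, ?_⟩
    rw [fWord_ofFn_succ, hz, Nat.succ_add_eq_add_succ]
    rfl

lemma clusterPt_mem {a : ℝ} (ha : 0 < a) {ε : ℕ → Bool} {t : EReal}
    (h : MapClusterPt t atTop (fun n => uSeq a n ε)) : t ∈ Iset a ε := by
  refine Set.mem_iInter.2 fun n => ?_
  refine isClosed_iff_clusterPt.1 (isClosed_range_fWord ha _) t (ClusterPt.mono h ?_)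
  rw [le_principal_iff, mem_map]
  filter_upwards [eventually_ge_atTop n] with m hm
  obtain ⟨k, rfl⟩ := Nat.exists_eq_add_of_le hm
  exact uSeq_mem a n k ε

lemma Iset_step {a : ℝ} (ha : 0 < a) {ε : ℕ → Bool} {t : EReal} (ht : t ∈ Iset a ε) :
    ∃ x, fSgn a (ε 0) x = t ∧ x ∈ Iset a (fun k => ε (k + 1)) := by
  have ht' := Set.mem_iInter.1 ht
  obtain ⟨z, hz⟩ := ht' 1
  rw [fWord_ofFn_succ] at hz
  refine ⟨_, hz, Set.mem_iInter.2 fun n => ?_⟩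
  obtain ⟨w, hw⟩ := ht' (n + 1)
  rw [fWord_ofFn_succ, ← hz] at hw
  exact ⟨w, fSgn_injective ha _ hw⟩

lemma mem_some_Iset {a : ℝ} (ha : 0 < a) (t : EReal) : ∃ ε, t ∈ Iset a ε := by
  choose s g hsg using fSgn_surj ha
  refine ⟨fun n => s (g^[n] t), Set.mem_iInter.2 fun n => ⟨g^[n] t, ?_⟩⟩
  induction n generalizing t with
  | zero => simp [fWord]
  | succ n ih =>
    rw [fWord_ofFn_succ a n (fun n => s (g^[n] t))]
    have := ih (g t)
    simp only [Function.iterate_succ, Function.comp_apply, Function.iterate_zero, id] at this ⊢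
    rw [this, hsg]

lemma step_between {a : ℝ} (ha : 0 < a) {ε δ : ℕ → Bool} {x y t : EReal}
    (hx : x ∈ Iset a ε) (hy : y ∈ Iset a ε) (ht : t ∈ Iset a δ) (h1 : x < t) (h2 : t < y) :
    ε 0 = δ 0 ∧ ∃ x' y' t', x' ∈ Iset a (fun k => ε (k + 1)) ∧ y' ∈ Iset a (fun k => ε (k + 1)) ∧
      t' ∈ Iset a (fun k => δ (k + 1)) ∧ x' < t' ∧ t' < y' := by
  obtain ⟨x', rfl, hx'⟩ := Iset_step ha hx
  obtain ⟨y', rfl, hy'⟩ := Iset_step ha hy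
  obtain ⟨t', rfl, ht'⟩ := Iset_step ha ht
  cases he : ε 0 <;> cases hd : δ 0 <;> rw [he, hd] at h1 <;> rw [he, hd] at h2
  · exact ⟨rfl, y', x', t', hy', hx', ht', (fF_strictAnti ha).lt_iff_gt.1 h2,
      (fF_strictAnti ha).lt_iff_gt.1 h1⟩
  · exact absurd (h2.trans_le (fF_nonpos a y')) (not_lt.2 (fT_nonneg a t'))
  · exact absurd ((fT_nonneg a x').trans_lt h1) (not_lt.2 (fF_nonpos a t'))
  · exact ⟨rfl, x', y', t', hx', hy', ht', (fT_strictMono ha).lt_iff_lt.1 h1,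
      (fT_strictMono ha).lt_iff_lt.1 h2⟩

lemma eq_of_between {a : ℝ} (ha : 0 < a) {ε δ : ℕ → Bool} {x y t : EReal}
    (hx : x ∈ Iset a ε) (hy : y ∈ Iset a ε) (ht : t ∈ Iset a δ) (h1 : x < t) (h2 : t < y) :
    ε = δ := by
  funext n
  induction n generalizing ε δ x y t with
  | zero => exact (step_between ha hx hy ht h1 h2).1
  | succ n ih =>
    obtain ⟨-, x', y', t', hx', hy', ht', h1', h2'⟩ := step_between ha hx hy ht h1 h2
    exact ih hx' hy' ht' h1' h2'

lemma subsingleton_of_representable {a : ℝ} (ha : 0 < a) (H : ∀ t : EReal, Representable a t)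
    (ε : ℕ → Bool) : (Iset a ε).Subsingleton := by
  have key : ∀ x ∈ Iset a ε, ∀ y ∈ Iset a ε, ¬ x < y := by
    intro x hx y hy hxy
    have rep : ∀ t, x < t → t < y → Represents a ε t := by
      intro t h1 h2
      obtain ⟨δ, hδ⟩ := H t
      have hm : t ∈ Iset a δ := clusterPt_mem ha (Tendsto.mapClusterPt hδ)
      rw [eq_of_between ha hx hy hm h1 h2]
      exact hδ
    obtain ⟨t, h1, h2⟩ := exists_between hxy
    obtain ⟨r, h3, h4⟩ := exists_between h2
    exact h3.ne (tendsto_nhds_unique (rep t h1 h2) (rep r (h1.trans h3) h4))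
  intro x hx y hy
  exact le_antisymm (not_lt.1 (key y hy x hx)) (not_lt.1 (key x hx y hy))

lemma represents_of_mem {a : ℝ} (ha : 0 < a) {ε : ℕ → Bool} (H : (Iset a ε).Subsingleton)
    {t : EReal} (ht : t ∈ Iset a ε) : Represents a ε t :=
  tendsto_nhds_of_unique_mapClusterPt fun _ hy => H (clusterPt_mem ha hy) ht

lemma suitable_of_subsingleton {a : ℝ} (ha : 0 < a) (H : ∀ ε, (Iset a ε).Subsingleton) :
    (∀ ε : ℕ → Bool, ∃ t : EReal, Represents a ε t) ∧ ∀ t : EReal, Representable a t := by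
  constructor
  · intro ε
    obtain ⟨t, ht⟩ := exists_clusterPt_of_compactSpace (map (fun n => uSeq a n ε) atTop)
    exact ⟨t, represents_of_mem ha (H ε) (clusterPt_mem ha ht)⟩
  · intro t
    obtain ⟨ε, hε⟩ := mem_some_Iset ha t
    exact ⟨ε, represents_of_mem ha (H ε) hε⟩

/-- The following are equivalent: (i) every element of `EReal` is representable;
(ii) every `I(ε)` is a subsingleton; (iii) `a` is suitable. -/
theorem suitable_tfae (a : ℝ) (ha : 0 < a) :
    ((∀ t : EReal, Representable a t) ↔ (∀ ε : ℕ → Bool, (Iset a ε).Subsingleton)) ∧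
      ((∀ ε : ℕ → Bool, (Iset a ε).Subsingleton) ↔
        ((∀ ε : ℕ → Bool, ∃ t : EReal, Represents a ε t) ∧
          ∀ t : EReal, Representable a t)) := by
  exact ⟨⟨subsingleton_of_representable ha, fun H => (suitable_of_subsingleton ha H).2⟩,
    ⟨suitable_of_subsingleton ha, fun H => subsingleton_of_representable ha H.2⟩⟩
end
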